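/- Let 0 < δ ≤ 1. There is a constant C(δ) such that for every k ∈ ℤ² with k ≠ 0, Σ_{h ∈ ℤ², h ≠ 0, h ≠ k, ‖h‖ ≤ 2‖k‖} ‖h‖^{−2δ}·‖k−h‖^{−2} ≤ C(δ). -/

import Mathlib

/-- The Euclidean norm of a lattice point `k ∈ ℤ²`. -/
noncomputable def znorm (k : ℤ × ℤ) : ℝ := Real.sqrt ((k.1 : ℝ) ^ 2 + (k.2 : ℝ) ^ 2)

lemma znorm_nonneg (k : ℤ × ℤ) : 0 ≤ znorm k := Real.sqrt_nonneg _

lemma znorm_pos {k : ℤ × ℤ} (hk : k ≠ 0) : 0 < znorm k := by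
  refine Real.sqrt_pos.2 ?_
  by_cases h1 : k.1 = 0
  · have h2 : k.2 ≠ 0 := fun h2 => hk (Prod.ext h1 h2)
    have : (k.2 : ℝ) ≠ 0 := by exact_mod_cast h2
    positivity
  · have : (k.1 : ℝ) ≠ 0 := by exact_mod_cast h1
    positivity

lemma norm_le_znorm (k : ℤ × ℤ) : ‖k‖ ≤ znorm k := by
  rw [Prod.norm_def, Int.norm_eq_abs, Int.norm_eq_abs]
  exact max_le (Real.abs_le_sqrt (by nlinarith [sq_nonneg (k.2 : ℝ)]))
    (Real.abs_le_sqrt (by nlinarith [sq_nonneg (k.1 : ℝ)]))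

lemma summable_znorm_rpow {s : ℝ} (hs : 2 < s) :
    Summable fun k : ℤ × ℤ => znorm k ^ (-s) := by
  have hnorm : Summable fun k : ℤ × ℤ => ‖k‖ ^ (-s) := by
    rw [← (finTwoArrowEquiv ℤ).summable_iff]
    refine (EisensteinSeries.summable_one_div_norm_rpow hs).congr fun x => ?_
    simp [Prod.norm_def, EisensteinSeries.norm_eq_max_natAbs, Int.norm_eq_abs, Nat.cast_natAbs]
  refine hnorm.of_nonneg_of_le (fun k => Real.rpow_nonneg (znorm_nonneg k) _) fun k => ?_
  rcases eq_or_ne k 0 with rfl | hk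
  · simp [znorm]
  · exact Real.rpow_le_rpow_of_nonpos (norm_pos_iff.2 hk) (norm_le_znorm k) (by linarith)

lemma rpow_neg_mul_rpow_neg_le {a b p q : ℝ} (ha : 0 < a) (hb : 0 < b) (hp : 0 ≤ p)
    (hq : 0 ≤ q) : a ^ (-p) * b ^ (-q) ≤ a ^ (-(p + q)) + b ^ (-(p + q)) := by
  rw [neg_add, Real.rpow_add ha, Real.rpow_add hb]
  rcases le_total a b with h | h
  · have := Real.rpow_le_rpow_of_nonpos ha h (neg_nonpos.2 hq)
    exact (mul_le_mul_of_nonneg_left this (by positivity)).trans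
      (le_add_of_nonneg_right (by positivity))
  · have := Real.rpow_le_rpow_of_nonpos hb h (neg_nonpos.2 hp)
    exact (mul_le_mul_of_nonneg_right this (by positivity)).trans
      (le_add_of_nonneg_left (by positivity))


/-- The two-dimensional lattice estimate used for the low-frequency part `S₂^{lo}` in the
proof of Proposition 4.1: for `0 < δ ≤ 1` there is a constant `C(δ)` such that for every
`k ≠ 0`, `Σ_{h≠0, h≠k, ‖h‖ ≤ 2‖k‖} ‖h‖^{−2δ}·‖k−h‖^{−2} ≤ C(δ)`, uniformly in `k`
(the sum being finite). -/
theorem lattice_low_frequency_estimate (δ : ℝ) (hδ : 0 < δ) (hδ1 : δ ≤ 1) :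
    ∃ C : ℝ, 0 < C ∧ ∀ k : ℤ × ℤ, k ≠ 0 →
      Summable (fun h : {h : ℤ × ℤ // h ≠ 0 ∧ h ≠ k ∧ znorm h ≤ 2 * znorm k} =>
        znorm (h : ℤ × ℤ) ^ (-(2 * δ)) * znorm (k - (h : ℤ × ℤ)) ^ (-2 : ℝ)) ∧
      (∑' h : {h : ℤ × ℤ // h ≠ 0 ∧ h ≠ k ∧ znorm h ≤ 2 * znorm k},
        znorm (h : ℤ × ℤ) ^ (-(2 * δ)) * znorm (k - (h : ℤ × ℤ)) ^ (-2 : ℝ)) ≤ C := by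
  set G : ℤ × ℤ → ℝ := fun h => znorm h ^ (-(2 * δ + 2))
  have hG0 : ∀ h, 0 ≤ G h := fun h => Real.rpow_nonneg (znorm_nonneg h) _
  have hGs : Summable G := summable_znorm_rpow (by linarith)
  have hG_tsum : 0 ≤ ∑' h, G h := tsum_nonneg hG0
  refine ⟨2 * ∑' h, G h + 1, by linarith, fun k _ => ?_⟩
  have hGk : Summable fun h => G (k - h) := (Equiv.subLeft k).summable_iff.2 hGs
  have hGk_tsum : ∑' h, G (k - h) = ∑' h, G h := (Equiv.subLeft k).tsum_eq G
  have hsum : Summable fun h => G h + G (k - h) := hGs.add hGk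
  set S : Set (ℤ × ℤ) := {h | h ≠ 0 ∧ h ≠ k ∧ znorm h ≤ 2 * znorm k}
  have hle : ∀ h : S, znorm (h : ℤ × ℤ) ^ (-(2 * δ)) * znorm (k - (h : ℤ × ℤ)) ^ (-2 : ℝ) ≤
      G h + G (k - h) := fun h =>
    rpow_neg_mul_rpow_neg_le (znorm_pos h.2.1) (znorm_pos (sub_ne_zero.2 h.2.2.1.symm))
      (by linarith) (by norm_num)
  have hS : Summable fun h : S => G h + G (k - h) := hsum.subtype S
  have hf : Summable fun h : S =>
      znorm (h : ℤ × ℤ) ^ (-(2 * δ)) * znorm (k - (h : ℤ × ℤ)) ^ (-2 : ℝ) :=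
    hS.of_nonneg_of_le (fun _ => mul_nonneg (Real.rpow_nonneg (znorm_nonneg _) _)
      (Real.rpow_nonneg (znorm_nonneg _) _)) hle
  refine ⟨hf, (hf.tsum_le_tsum hle hS).trans ?_⟩
  calc ∑' h : S, (G h + G (k - h)) ≤ ∑' h, (G h + G (k - h)) :=
        hsum.tsum_subtype_le _ S fun _ => add_nonneg (hG0 _) (hG0 _)
    _ = 2 * ∑' h, G h := by rw [hGs.tsum_add hGk, hGk_tsum, two_mul]
    _ ≤ 2 * ∑' h, G h + 1 := by linarith
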